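/- For all τ in the complex upper half-plane ℍ and all z ∈ ℂ, one has (1/12)·φ_{0,1}(τ,z) + 2·Λ_2(τ)·φ_{-2,1}(τ,z) = ϑ_2(τ,z)²/ϑ_2(τ,0)². -/

import Mathlib

noncomputable section

open Complex

/-- `2πi`. -/
def twoPiI : ℂ := 2 * Real.pi * Complex.I

/-- `q = e^{2πiτ}`. -/
def qq (τ : ℂ) : ℂ := Complex.exp (twoPiI * τ)

/-- `y = e^{2πiz}`. -/
def yy (z : ℂ) : ℂ := Complex.exp (twoPiI * z)

/-- Jacobi theta function `ϑ₁`. -/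
def th1 (τ z : ℂ) : ℂ :=
  -Complex.I * ∑' n : ℤ, (-1 : ℂ) ^ n *
    Complex.exp (twoPiI * (((n : ℂ) + 1/2) * z + ((n : ℂ) + 1/2) ^ 2 / 2 * τ))

/-- Jacobi theta function `ϑ₂`. -/
def th2 (τ z : ℂ) : ℂ :=
  ∑' n : ℤ, Complex.exp (twoPiI * (((n : ℂ) + 1/2) * z + ((n : ℂ) + 1/2) ^ 2 / 2 * τ))

/-- Jacobi theta function `ϑ₃`. -/
def th3 (τ z : ℂ) : ℂ :=
  ∑' n : ℤ, Complex.exp (twoPiI * ((n : ℂ) * z + (n : ℂ) ^ 2 / 2 * τ))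

/-- Jacobi theta function `ϑ₄`. -/
def th4 (τ z : ℂ) : ℂ :=
  ∑' n : ℤ, (-1 : ℂ) ^ n * Complex.exp (twoPiI * ((n : ℂ) * z + (n : ℂ) ^ 2 / 2 * τ))

/-- The Dedekind eta function `η(τ) = q^{1/24} ∏_{n≥1} (1 - qⁿ)`. -/
def etaF (τ : ℂ) : ℂ :=
  Complex.exp (twoPiI * τ / 24) * ∏' n : ℕ, (1 - qq τ ^ (n + 1))

/-- The quasimodular Eisenstein series `E₂(τ) = 1 - 24 ∑_{n≥1} σ₁(n) qⁿ`. -/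
def E2 (τ : ℂ) : ℂ :=
  1 - 24 * ∑' n : ℕ, (∑ d ∈ Nat.divisors (n + 1), (d : ℂ)) * qq τ ^ (n + 1)

/-- `Λ_N(τ) = (N/24)(N E₂(Nτ) - E₂(τ))`. -/
def Lam (N : ℕ) (τ : ℂ) : ℂ := (N : ℂ) / 24 * ((N : ℂ) * E2 ((N : ℂ) * τ) - E2 τ)

/-- The weak Jacobi form `φ_{0,1}`. -/
def phi01 (τ z : ℂ) : ℂ :=
  4 * (th2 τ z ^ 2 / th2 τ 0 ^ 2 + th3 τ z ^ 2 / th3 τ 0 ^ 2 + th4 τ z ^ 2 / th4 τ 0 ^ 2)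

/-- The weak Jacobi form `φ_{-2,1}`. -/
def phim21 (τ z : ℂ) : ℂ := -(th1 τ z ^ 2) / etaF τ ^ 6

/-- The infinite `q`-Pochhammer symbol `∏_{k ≥ 0} (1 - a xᵏ)`. -/
def qPoch (a x : ℂ) : ℂ := ∏' k : ℕ, (1 - a * x ^ k)

lemma multipliable_qPoch (a : ℂ) {x : ℂ} (hx : ‖x‖ < 1) :
    Multipliable fun k : ℕ ↦ 1 - a * x ^ k := by
  have hs : Summable fun k : ℕ ↦ ‖-(a * x ^ k)‖ := by
    simp_rw [norm_neg, norm_mul, norm_pow]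
    exact (summable_geometric_of_lt_one (norm_nonneg _) hx).mul_left ‖a‖
  simpa only [← sub_eq_add_neg] using multipliable_one_add_of_summable hs

lemma qPoch_eq_mul (a : ℂ) {x : ℂ} (hx : ‖x‖ < 1) :
    qPoch a x = (1 - a) * qPoch (a * x) x := by
  have e : (fun k : ℕ ↦ 1 - a * x * x ^ k) = fun k ↦ 1 - a * x ^ (k + 1) := by
    ext k
    ring
  have h := multipliable_qPoch (a * x) hx
  rw [e] at h
  rw [qPoch, qPoch, e, tprod_eq_zero_mul' (f := fun k ↦ 1 - a * x ^ k) h, pow_zero, mul_one]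

lemma norm_sq_lt_one {x : ℂ} (hx : ‖x‖ < 1) : ‖x ^ 2‖ < 1 := by
  rw [norm_pow]; exact pow_lt_one₀ (norm_nonneg _) hx two_ne_zero

lemma qPoch_even_mul_odd (a : ℂ) {x : ℂ} (hx : ‖x‖ < 1) :
    qPoch a x = qPoch a (x ^ 2) * qPoch (a * x) (x ^ 2) := by
  have h1 := multipliable_qPoch a (norm_sq_lt_one hx)
  have h2 := multipliable_qPoch (a * x) (norm_sq_lt_one hx)
  have e1 : (fun k : ℕ ↦ 1 - a * (x ^ 2) ^ k) = fun k ↦ 1 - a * x ^ (2 * k) := by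
    simp_rw [pow_mul]
  have e2 : (fun k : ℕ ↦ 1 - a * x * (x ^ 2) ^ k) = fun k ↦ 1 - a * x ^ (2 * k + 1) := by
    ext k
    ring
  rw [e1] at h1
  rw [e2] at h2
  simp only [qPoch]
  rw [e1, e2]
  exact (tprod_even_mul_odd (f := fun k ↦ 1 - a * x ^ k) h1 h2).symm

lemma qPoch_mul_qPoch_neg (a : ℂ) {x : ℂ} (hx : ‖x‖ < 1) :
    qPoch a x * qPoch (-a) x = qPoch (a ^ 2) (x ^ 2) := by
  simp only [qPoch]
  rw [← (multipliable_qPoch a hx).tprod_mul (multipliable_qPoch (-a) hx)]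
  exact tprod_congr fun k ↦ by ring

lemma qPoch_self_ne_zero {x : ℂ} (hx : ‖x‖ < 1) : qPoch x x ≠ 0 := by
  have : (fun k : ℕ ↦ 1 - x * x ^ k) = fun k ↦ 1 + -(x ^ (k + 1)) := by
    ext k; ring
  simp only [qPoch, this]
  refine tprod_one_add_ne_zero_of_summable (f := fun k ↦ -(x ^ (k + 1))) (fun k h ↦ ?_) ?_
  · have h1 : x ^ (k + 1) = 1 := by linear_combination -h
    have h2 : ‖x‖ ^ (k + 1) < 1 := pow_lt_one₀ (norm_nonneg _) hx k.succ_ne_zero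
    rw [← norm_pow, h1, norm_one] at h2
    exact lt_irrefl _ h2
  · simpa using (summable_nat_add_iff 1).mpr (summable_geometric_of_lt_one (norm_nonneg _) hx)

lemma continuous_qPoch {x : ℂ} (hx : ‖x‖ < 1) : Continuous fun a ↦ qPoch a x := by
  rw [continuous_iff_continuousAt]
  intro a
  have hs : Summable fun k : ℕ ↦ (‖a‖ + 1) * ‖x‖ ^ k :=
    (summable_geometric_of_lt_one (norm_nonneg _) hx).mul_left _
  have h := Summable.hasProdLocallyUniformlyOn_nat_one_add (f := fun (k : ℕ) (b : ℂ) ↦ -(b * x ^ k))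
    (Metric.isOpen_ball (x := (0 : ℂ)) (ε := ‖a‖ + 1)) hs
    (.of_forall fun k b hb ↦ by
      rw [norm_neg, norm_mul, norm_pow]
      have : ‖b‖ ≤ ‖a‖ + 1 := by simpa using (mem_ball_zero_iff.mp hb).le
      gcongr) (fun k ↦ by fun_prop)
  have hc := h.tendstoLocallyUniformlyOn_finsetRange.continuousOn
    (.of_forall fun n ↦ by fun_prop)
  simp only [← sub_eq_add_neg] at hc
  exact hc.continuousAt (Metric.isOpen_ball.mem_nhds (by simp))

/-- The reciprocal of `∏_{k=1}^{n} (1 - xᵏ)`, extended by zero to negative `n`. -/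
def qFactInv (x : ℂ) (n : ℤ) : ℂ :=
  if n < 0 then 0 else (∏ k ∈ Finset.range n.toNat, (1 - x * x ^ k))⁻¹

lemma one_sub_pow_succ_ne_zero {x : ℂ} (hx : ‖x‖ < 1) (k : ℕ) : 1 - x * x ^ k ≠ 0 := by
  rw [← pow_succ']
  intro h
  have h1 : x ^ (k + 1) = 1 := by linear_combination -h
  have h2 : ‖x‖ ^ (k + 1) < 1 := pow_lt_one₀ (norm_nonneg _) hx k.succ_ne_zero
  rw [← norm_pow, h1, norm_one] at h2
  exact lt_irrefl _ h2

lemma qFactInv_sub_one {x : ℂ} (hx : ‖x‖ < 1) (n : ℤ) :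
    qFactInv x (n - 1) = (1 - x ^ n) * qFactInv x n := by
  rcases lt_trichotomy n 0 with h | rfl | h
  · simp [qFactInv, h, show n - 1 < 0 by omega]
  · simp [qFactInv]
  · obtain ⟨m, rfl⟩ : ∃ m : ℕ, n = m + 1 := ⟨(n - 1).toNat, by omega⟩
    have h0 := one_sub_pow_succ_ne_zero hx m
    have h1 : ((m : ℤ) + 1).toNat = m + 1 := by omega
    rw [qFactInv, qFactInv, if_neg (by omega), if_neg (by omega), h1, add_sub_cancel_right,
      Int.toNat_natCast, Finset.prod_range_succ, mul_inv, mul_comm, mul_assoc]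
    have h2 : x ^ ((m : ℤ) + 1) = x * x ^ m := by
      rw [← pow_succ']; exact_mod_cast zpow_natCast x (m + 1)
    rw [h2, inv_mul_cancel₀ h0, mul_one]

lemma tendsto_prod_qPoch {x : ℂ} (hx : ‖x‖ < 1) (a : ℂ) :
    Filter.Tendsto (fun n ↦ ∏ k ∈ Finset.range n, (1 - a * x ^ k)) Filter.atTop
      (nhds (qPoch a x)) :=
  (multipliable_qPoch a hx).hasProd.tendsto_prod_nat

lemma exists_norm_prod_le {x : ℂ} (hx : ‖x‖ < 1) :
    ∃ C, ∀ n, ‖∏ k ∈ Finset.range n, (1 - x * x ^ k)‖ ≤ C := by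
  obtain ⟨C, hC⟩ := (Metric.isBounded_range_of_tendsto _ (tendsto_prod_qPoch hx x)).exists_norm_le
  exact ⟨C, fun n ↦ hC _ ⟨n, rfl⟩⟩

lemma exists_norm_qFactInv_le {x : ℂ} (hx : ‖x‖ < 1) : ∃ C, 0 ≤ C ∧ ∀ n, ‖qFactInv x n‖ ≤ C := by
  obtain ⟨C, hC⟩ := (Metric.isBounded_range_of_tendsto _
    ((tendsto_prod_qPoch hx x).inv₀ (qPoch_self_ne_zero hx))).exists_norm_le
  have hC0 : 0 ≤ C := (norm_nonneg _).trans (hC _ ⟨0, rfl⟩)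
  refine ⟨C, hC0, fun n ↦ ?_⟩
  rw [qFactInv]
  split_ifs
  · simpa using hC0
  · exact hC _ ⟨n.toNat, rfl⟩

lemma tendsto_qFactInv {x : ℂ} (hx : ‖x‖ < 1) (f : ℕ → ℤ)
    (hf : Filter.Tendsto f Filter.atTop Filter.atTop) :
    Filter.Tendsto (fun n ↦ qFactInv x (f n)) Filter.atTop (nhds (qPoch x x)⁻¹) := by
  have h1 : Filter.Tendsto (fun n ↦ (f n).toNat) Filter.atTop Filter.atTop :=
    Filter.tendsto_atTop.mpr fun b ↦
      (hf.eventually_ge_atTop (b : ℤ)).mono fun n hn ↦ by omega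
  refine (((tendsto_prod_qPoch hx x).inv₀ (qPoch_self_ne_zero hx)).comp h1).congr' ?_
  filter_upwards [hf.eventually_ge_atTop 0] with n hn
  simp [qFactInv, not_lt.mpr hn]

lemma cexp_two_pi_norm_lt {τ : ℂ} (hτ : 0 < τ.im) : ‖Complex.exp (Real.pi * I * τ)‖ < 1 := by
  rw [norm_exp]
  simpa using mul_pos Real.pi_pos hτ

lemma jacobiTheta₂_term_succ (j : ℤ) (z τ : ℂ) :
    jacobiTheta₂_term (j + 1) z τ = jacobiTheta₂_term j z τ *
      (Complex.exp (2 * Real.pi * I * z) * Complex.exp (Real.pi * I * τ) ^ (2 * j + 1)) := by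
  rw [jacobiTheta₂_term, jacobiTheta₂_term, ← Complex.exp_int_mul, ← Complex.exp_add,
    ← Complex.exp_add]
  congr 1
  push_cast
  ring

/-- The finite form of the Jacobi triple product. -/
lemma hasSum_finite_triple_product (z : ℂ) {τ : ℂ} (hτ : 0 < τ.im) (N : ℕ) :
    HasSum (fun j : ℤ ↦ (∏ k ∈ Finset.range (2 * N), (1 - Complex.exp (Real.pi * I * τ) ^ 2 *
        (Complex.exp (Real.pi * I * τ) ^ 2) ^ k)) * qFactInv (Complex.exp (Real.pi * I * τ) ^ 2) (N - j) *
        qFactInv (Complex.exp (Real.pi * I * τ) ^ 2) (N + j) * jacobiTheta₂_term j z τ)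
      (∏ k ∈ Finset.range N, ((1 + Complex.exp (2 * Real.pi * I * z) * Complex.exp (Real.pi * I * τ) ^ (2 * k + 1))
        * (1 + (Complex.exp (2 * Real.pi * I * z))⁻¹ * Complex.exp (Real.pi * I * τ) ^ (2 * k + 1)))) := by
  have hsucc := fun j ↦ jacobiTheta₂_term_succ j z τ
  have hp := cexp_two_pi_norm_lt hτ
  have hp0 : Complex.exp (Real.pi * I * τ) ≠ 0 := Complex.exp_ne_zero _
  have hw0 : Complex.exp (2 * Real.pi * I * z) ≠ 0 := Complex.exp_ne_zero _
  have he0 : jacobiTheta₂_term 0 z τ = 1 := by simp [jacobiTheta₂_term]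
  generalize Complex.exp (Real.pi * I * τ) = p at *
  generalize Complex.exp (2 * Real.pi * I * z) = w at *
  have hq := norm_sq_lt_one hp
  induction N with
  | zero =>
    have h0 : ∀ j : ℤ, j ≠ 0 → qFactInv (p ^ 2) (0 - j) * qFactInv (p ^ 2) (0 + j) = 0 := by
      intro j hj
      rcases lt_or_gt_of_ne hj with h | h <;> simp [qFactInv, h]
    have h1 := hasSum_single (f := fun j : ℤ ↦ qFactInv (p ^ 2) (0 - j) *
      qFactInv (p ^ 2) (0 + j) * jacobiTheta₂_term j z τ) 0 fun j hj ↦ by rw [h0 j hj, zero_mul]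
    simpa [qFactInv, he0] using h1
  | succ N ih =>
    rw [Finset.prod_range_succ]
    have ih1 := ((Equiv.addRight (-1 : ℤ)).hasSum_iff.mpr ih).mul_right (w * p ^ (2 * N + 1))
    have ih2 := ((Equiv.addRight (1 : ℤ)).hasSum_iff.mpr ih).mul_right (w⁻¹ * p ^ (2 * N + 1))
    have ih3 := ih.mul_right (1 + p ^ (4 * N + 2))
    convert! (ih1.add ih2).add ih3 using 1
    · ext j
      simp only [Function.comp, Equiv.coe_addRight]
      have h1 : jacobiTheta₂_term (j + -1) z τ * (w * p ^ (2 * N + 1)) =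
          jacobiTheta₂_term j z τ * (p ^ 2) ^ ((N : ℤ) + 1 - j) := by
        have := hsucc (j + -1)
        rw [neg_add_cancel_right] at this
        rw [this, mul_assoc, mul_assoc, ← zpow_natCast p 2, ← zpow_mul, ← zpow_add₀ hp0,
          ← zpow_natCast p]
        congr 4
        push_cast
        ring
      have h2 : jacobiTheta₂_term (j + 1) z τ * (w⁻¹ * p ^ (2 * N + 1)) =
          jacobiTheta₂_term j z τ * (p ^ 2) ^ ((N : ℤ) + 1 + j) := by
        have e1 : (p ^ 2) ^ ((N : ℤ) + 1 + j) = p ^ (2 * j + 1) * p ^ (2 * N + 1) := by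
          rw [← zpow_natCast p, ← zpow_natCast p, ← zpow_mul, ← zpow_add₀ hp0]
          congr 1
          push_cast
          ring
        rw [hsucc, e1]
        field_simp
      have hq0 : p ^ 2 ≠ 0 := pow_ne_zero _ hp0
      have hAB : (p ^ 2) ^ ((N : ℤ) + 1 - j) * (p ^ 2) ^ ((N : ℤ) + 1 + j) = p ^ (4 * N + 4) := by
        rw [← zpow_add₀ hq0, ← zpow_natCast p, ← zpow_natCast p, ← zpow_mul]
        congr 1
        push_cast
        ring
      have ha := qFactInv_sub_one hq ((N : ℤ) + 1 - j)
      have hb := qFactInv_sub_one hq ((N : ℤ) + 1 + j)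
      have ha' := qFactInv_sub_one hq ((N : ℤ) + 1 - j - 1)
      have hb' := qFactInv_sub_one hq ((N : ℤ) + 1 + j - 1)
      rw [ha, zpow_sub_one₀ hq0] at ha'
      rw [hb, zpow_sub_one₀ hq0] at hb'
      have hP : ∏ k ∈ Finset.range (2 * (N + 1)), (1 - p ^ 2 * (p ^ 2) ^ k) =
          (∏ k ∈ Finset.range (2 * N), (1 - p ^ 2 * (p ^ 2) ^ k)) *
            ((1 - p ^ (4 * N + 2)) * (1 - p ^ (4 * N + 4))) := by
        rw [show 2 * (N + 1) = 2 * N + 1 + 1 by ring, Finset.prod_range_succ,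
          Finset.prod_range_succ]
        ring
      have i1 : (N : ℤ) - (j + -1) = N + 1 - j := by ring
      have i2 : (N : ℤ) + (j + -1) = N + 1 + j - 1 - 1 := by ring
      have i3 : (N : ℤ) - (j + 1) = N + 1 - j - 1 - 1 := by ring
      have i4 : (N : ℤ) + (j + 1) = N + 1 + j := by ring
      have i5 : (N : ℤ) - j = N + 1 - j - 1 := by ring
      have i6 : (N : ℤ) + j = N + 1 + j - 1 := by ring
      rw [mul_assoc _ (jacobiTheta₂_term (j + -1) z τ), h1,
        mul_assoc _ (jacobiTheta₂_term (j + 1) z τ), h2, hP, i1, i2, i3, i4, i5, i6, ha', hb',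
        ha, hb]
      push_cast
      have hr : p ^ (4 * N + 2) = (p ^ 2) ^ ((N : ℤ) + 1 - j) * (p ^ 2) ^ ((N : ℤ) + 1 + j)
          * (p ^ 2)⁻¹ := by
        rw [hAB, eq_mul_inv_iff_mul_eq₀ hq0]
        ring
      rw [hr, ← hAB]
      ring
    · field_simp
      ring

/-- The **Jacobi triple product**. -/
theorem jacobiTheta₂_eq_qPoch (z : ℂ) {τ : ℂ} (hτ : 0 < τ.im) :
    jacobiTheta₂ z τ = qPoch (Complex.exp (Real.pi * I * τ) ^ 2) (Complex.exp (Real.pi * I * τ) ^ 2) *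
      (qPoch (-(Complex.exp (2 * Real.pi * I * z) * Complex.exp (Real.pi * I * τ))) (Complex.exp (Real.pi * I * τ) ^ 2) *
      qPoch (-((Complex.exp (2 * Real.pi * I * z))⁻¹ * Complex.exp (Real.pi * I * τ)))
        (Complex.exp (Real.pi * I * τ) ^ 2)) := by
  have hfin := hasSum_finite_triple_product z hτ
  have hp := cexp_two_pi_norm_lt hτ
  generalize Complex.exp (Real.pi * I * τ) = p at *
  generalize Complex.exp (2 * Real.pi * I * z) = w at *
  have hq := norm_sq_lt_one hp
  have hφ := qPoch_self_ne_zero hq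
  have hlim1 : Filter.Tendsto (fun N ↦ ∏ k ∈ Finset.range N, ((1 + w * p ^ (2 * k + 1))
        * (1 + w⁻¹ * p ^ (2 * k + 1)))) Filter.atTop
      (nhds (qPoch (-(w * p)) (p ^ 2) * qPoch (-(w⁻¹ * p)) (p ^ 2))) := by
    refine ((tendsto_prod_qPoch hq (-(w * p))).mul
      (tendsto_prod_qPoch hq (-(w⁻¹ * p)))).congr fun N ↦ ?_
    rw [← Finset.prod_mul_distrib]
    exact Finset.prod_congr rfl fun k _ ↦ by ring
  obtain ⟨C, hC⟩ := exists_norm_prod_le hq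
  obtain ⟨D, hD0, hD⟩ := exists_norm_qFactInv_le hq
  have hC0 : 0 ≤ C := (norm_nonneg _).trans (hC 0)
  have hlim2 : Filter.Tendsto (fun N : ℕ ↦ ∑' j : ℤ, (∏ k ∈ Finset.range (2 * N),
      (1 - p ^ 2 * (p ^ 2) ^ k)) * qFactInv (p ^ 2) (N - j) * qFactInv (p ^ 2) (N + j) *
        jacobiTheta₂_term j z τ) Filter.atTop
      (nhds (∑' j : ℤ, qPoch (p ^ 2) (p ^ 2) * (qPoch (p ^ 2) (p ^ 2))⁻¹ *
        (qPoch (p ^ 2) (p ^ 2))⁻¹ * jacobiTheta₂_term j z τ)) := by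
    refine tendsto_tsum_of_dominated_convergence
      (bound := fun j ↦ C * D * D * ‖jacobiTheta₂_term j z τ‖)
      (((summable_jacobiTheta₂_term_iff z τ).mpr hτ).norm.mul_left _) (fun j ↦ ?_)
      (.of_forall fun N j ↦ ?_)
    · refine Filter.Tendsto.mul_const _ (((tendsto_prod_qPoch hq _).comp ?_).mul ?_ |>.mul ?_)
      · exact Filter.tendsto_id.const_mul_atTop' two_pos
      · exact tendsto_qFactInv hq _
          (Filter.tendsto_atTop_add_const_right _ (-j) tendsto_natCast_atTop_atTop)
      · exact tendsto_qFactInv hq _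
          (Filter.tendsto_atTop_add_const_right _ j tendsto_natCast_atTop_atTop)
    · rw [norm_mul, norm_mul, norm_mul]
      gcongr
      · exact hC _
      · exact hD _
      · exact hD _
  simp_rw [(hfin _).tsum_eq] at hlim2
  have := tendsto_nhds_unique hlim1 hlim2
  rw [this, tsum_mul_left, mul_inv_cancel₀ hφ, one_mul, ← mul_assoc, mul_inv_cancel₀ hφ, one_mul]
  rfl

/-- Splitting a sum over pairs of integers by the parity of the sum of the two coordinates. -/
lemma tsum_prod_eq_add_sub {F : ℤ × ℤ → ℂ} (hF : Summable F) :
    ∑' p, F p = ∑' p : ℤ × ℤ, F (p.1 + p.2, p.1 - p.2) +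
      ∑' p : ℤ × ℤ, F (p.1 + p.2 + 1, p.1 - p.2) := by
  let g : (ℤ × ℤ) ⊕ (ℤ × ℤ) → ℤ × ℤ :=
    Sum.elim (fun p ↦ (p.1 + p.2, p.1 - p.2)) (fun p ↦ (p.1 + p.2 + 1, p.1 - p.2))
  have hg : Function.Bijective g := by
    constructor
    · rintro (⟨a, b⟩ | ⟨a, b⟩) (⟨c, d⟩ | ⟨c, d⟩) h <;>
        simp only [g, Sum.elim_inl, Sum.elim_inr, Prod.mk.injEq] at h
      · congr 2 <;> omega
      · omega
      · omega
      · congr 2 <;> omega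
    · rintro ⟨m, n⟩
      rcases Int.even_or_odd' (m + n) with ⟨c, hc | hc⟩
      · exact ⟨.inl (c, m - c), by simp only [g, Sum.elim_inl, Prod.mk.injEq]; omega⟩
      · exact ⟨.inr (c, m - c - 1), by simp only [g, Sum.elim_inr, Prod.mk.injEq]; omega⟩
  rw [← (Equiv.ofBijective g hg).tsum_eq]
  have hs : Summable (F ∘ g) := (Equiv.ofBijective g hg).summable_iff.mpr hF
  exact Summable.tsum_sum (f := F ∘ g) (hs.comp_injective Sum.inl_injective)
    (hs.comp_injective Sum.inr_injective)

/-- The addition formula for the product of two theta functions. -/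
lemma jacobiTheta₂_mul_jacobiTheta₂ (z w : ℂ) {τ : ℂ} (hτ : 0 < τ.im) :
    jacobiTheta₂ z τ * jacobiTheta₂ w τ =
      jacobiTheta₂ (z + w) (2 * τ) * jacobiTheta₂ (z - w) (2 * τ) +
      Complex.exp (2 * Real.pi * I * (z + τ / 2)) *
        (jacobiTheta₂ (z + w + τ) (2 * τ) * jacobiTheta₂ (z - w + τ) (2 * τ)) := by
  have h2τ : 0 < (2 * τ).im := by simpa using hτ
  have hs := fun u ↦ ((summable_jacobiTheta₂_term_iff u τ).mpr hτ).norm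
  have hs2 := fun u ↦ ((summable_jacobiTheta₂_term_iff u (2 * τ)).mpr h2τ).norm
  simp only [jacobiTheta₂]
  rw [tsum_mul_tsum_of_summable_norm (hs z) (hs w),
    tsum_prod_eq_add_sub (summable_mul_of_summable_norm (hs z) (hs w)),
    tsum_mul_tsum_of_summable_norm (hs2 _) (hs2 _),
    tsum_mul_tsum_of_summable_norm (hs2 _) (hs2 _), ← tsum_mul_left]
  congr 1 <;> refine tsum_congr fun p ↦ ?_
  · simp only [jacobiTheta₂_term, ← Complex.exp_add]
    congr 1
    push_cast
    ring
  · simp only [jacobiTheta₂_term, ← Complex.exp_add]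
    congr 1
    push_cast
    ring

lemma neg_one_zpow_eq_exp (n : ℤ) : (-1 : ℂ) ^ n = Complex.exp (Real.pi * I * n) := by
  rw [mul_comm, Complex.exp_int_mul, Complex.exp_pi_mul_I]

lemma th3_eq (τ z : ℂ) : th3 τ z = jacobiTheta₂ z τ := by
  refine tsum_congr fun n ↦ ?_
  rw [jacobiTheta₂_term, twoPiI]
  congr 1
  ring

lemma th4_eq (τ z : ℂ) : th4 τ z = jacobiTheta₂ (z + 1 / 2) τ := by
  refine tsum_congr fun n ↦ ?_
  rw [jacobiTheta₂_term, twoPiI, neg_one_zpow_eq_exp, ← Complex.exp_add]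
  congr 1
  ring

lemma th2_eq (τ z : ℂ) : th2 τ z =
    Complex.exp (Real.pi * I * (z + τ / 4)) * jacobiTheta₂ (z + τ / 2) τ := by
  rw [jacobiTheta₂, ← tsum_mul_left]
  refine tsum_congr fun n ↦ ?_
  rw [jacobiTheta₂_term, twoPiI, ← Complex.exp_add]
  congr 1
  ring

lemma th1_eq (τ z : ℂ) : th1 τ z = -I * (Complex.exp (Real.pi * I * (z + τ / 4)) *
    jacobiTheta₂ (z + 1 / 2 + τ / 2) τ) := by
  rw [jacobiTheta₂, ← tsum_mul_left, th1]
  congr 1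
  refine tsum_congr fun n ↦ ?_
  rw [jacobiTheta₂_term, twoPiI, neg_one_zpow_eq_exp, ← Complex.exp_add, ← Complex.exp_add]
  congr 1
  ring

/-- The four squares of theta functions are expressed through two theta functions
with doubled period. -/
lemma exists_theta_sq (τ : ℂ) (hτ : 0 < τ.im) : ∃ A B : ℂ → ℂ, ∀ z,
    th1 τ z ^ 2 = A z * B 0 - B z * A 0 ∧ th2 τ z ^ 2 = A z * B 0 + B z * A 0 ∧
    th3 τ z ^ 2 = A z * A 0 + B z * B 0 ∧ th4 τ z ^ 2 = A z * A 0 - B z * B 0 := by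
  refine ⟨fun z ↦ jacobiTheta₂ (2 * z) (2 * τ),
    fun z ↦ Complex.exp (2 * Real.pi * I * (z + τ / 4)) * jacobiTheta₂ (2 * z + τ) (2 * τ),
    fun z ↦ ?_⟩
  have hsq := fun z ↦ jacobiTheta₂_mul_jacobiTheta₂ z z hτ
  have hper : jacobiTheta₂ (2 * z + 2 * τ) (2 * τ) =
      Complex.exp (-(2 * Real.pi * I * (2 * z + τ))) * jacobiTheta₂ (2 * z) (2 * τ) := by
    rw [jacobiTheta₂_add_left']
    congr 2
    ring
  have h1 := hsq (z + 1 / 2 + τ / 2)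
  have h2 := hsq (z + τ / 2)
  have h3 := hsq z
  have h4 := hsq (z + 1 / 2)
  rw [show z + 1 / 2 + τ / 2 + (z + 1 / 2 + τ / 2) = 2 * z + τ + 1 by ring,
    show 2 * z + τ + 1 + τ = 2 * z + 2 * τ + 1 by ring, jacobiTheta₂_add_left,
    jacobiTheta₂_add_left, hper, sub_self, zero_add] at h1
  rw [show z + τ / 2 + (z + τ / 2) = 2 * z + τ by ring,
    show 2 * z + τ + τ = 2 * z + 2 * τ by ring, hper, sub_self, zero_add] at h2
  rw [show z + z = 2 * z by ring, sub_self, zero_add] at h3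
  rw [show z + 1 / 2 + (z + 1 / 2) = 2 * z + 1 by ring, show 2 * z + 1 + τ = 2 * z + τ + 1 by ring,
    jacobiTheta₂_add_left, jacobiTheta₂_add_left, sub_self, zero_add] at h4
  have hexp_half : Complex.exp (Real.pi * I) = -1 := Complex.exp_pi_mul_I
  have ea : Complex.exp (2 * Real.pi * I * (z + τ / 2)) =
      Complex.exp (2 * Real.pi * I * (z + τ / 4)) * Complex.exp (2 * Real.pi * I * (τ / 4)) := by
    rw [← Complex.exp_add]; congr 1; ring
  have eb : Complex.exp (2 * Real.pi * I * (z + 1 / 2 + τ / 2)) =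
      -Complex.exp (2 * Real.pi * I * (z + τ / 2)) := by
    rw [neg_eq_neg_one_mul, ← hexp_half, ← Complex.exp_add]; congr 1; ring
  have ec : Complex.exp (2 * Real.pi * I * (z + τ / 4)) *
      (Complex.exp (2 * Real.pi * I * (z + τ / 2 + τ / 2)) *
        Complex.exp (-(2 * Real.pi * I * (2 * z + τ)))) =
      Complex.exp (2 * Real.pi * I * (τ / 4)) := by
    rw [← Complex.exp_add, ← Complex.exp_add]; congr 1; ring
  have ed : Complex.exp (2 * Real.pi * I * (z + 1 / 2 + τ / 2 + τ / 2)) =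
      -Complex.exp (2 * Real.pi * I * (z + τ / 2 + τ / 2)) := by
    rw [neg_eq_neg_one_mul, ← hexp_half, ← Complex.exp_add]; congr 1; ring
  have ee : Complex.exp (Real.pi * I * (z + τ / 4)) ^ 2 =
      Complex.exp (2 * Real.pi * I * (z + τ / 4)) := by
    rw [← Complex.exp_nat_mul]; congr 1; push_cast; ring
  rw [ed] at h1
  rw [eb, ea] at h4
  rw [ea] at h3
  simp only [th1_eq, th2_eq, th3_eq, th4_eq, mul_zero, zero_add]
  refine ⟨?_, ?_, ?_, ?_⟩
  · rw [mul_pow, mul_pow, ee, pow_two (jacobiTheta₂ _ _), h1, neg_sq, I_sq, ← ec]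
    ring
  · rw [mul_pow, ee, pow_two (jacobiTheta₂ _ _), h2, ← ec]
    ring
  · rw [pow_two, h3]
    ring
  · rw [pow_two, h4]
    ring

lemma norm_nome_sq_lt_one {τ : ℂ} (hτ : 0 < τ.im) : ‖Complex.exp (Real.pi * I * τ) ^ 2‖ < 1 :=
  norm_sq_lt_one (cexp_two_pi_norm_lt hτ)

lemma th3_zero_eq {τ : ℂ} (hτ : 0 < τ.im) : th3 τ 0 =
    qPoch (Complex.exp (Real.pi * I * τ) ^ 2) (Complex.exp (Real.pi * I * τ) ^ 2) *
      qPoch (-Complex.exp (Real.pi * I * τ)) (Complex.exp (Real.pi * I * τ) ^ 2) ^ 2 := by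
  rw [th3_eq, jacobiTheta₂_eq_qPoch 0 hτ, mul_zero, Complex.exp_zero, inv_one, one_mul, pow_two
    (qPoch _ _)]

lemma th4_zero_eq {τ : ℂ} (hτ : 0 < τ.im) : th4 τ 0 =
    qPoch (Complex.exp (Real.pi * I * τ) ^ 2) (Complex.exp (Real.pi * I * τ) ^ 2) *
      qPoch (Complex.exp (Real.pi * I * τ)) (Complex.exp (Real.pi * I * τ) ^ 2) ^ 2 := by
  have h : Complex.exp (2 * Real.pi * I * (0 + 1 / 2)) = -1 := by
    rw [← Complex.exp_pi_mul_I]; congr 1; ring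
  rw [th4_eq, jacobiTheta₂_eq_qPoch _ hτ, h, pow_two (qPoch _ _)]
  norm_num

lemma th2_zero_eq {τ : ℂ} (hτ : 0 < τ.im) : th2 τ 0 = 2 * Complex.exp (Real.pi * I * (τ / 4)) *
    qPoch (Complex.exp (Real.pi * I * τ) ^ 2) (Complex.exp (Real.pi * I * τ) ^ 2) *
      qPoch (-Complex.exp (Real.pi * I * τ) ^ 2) (Complex.exp (Real.pi * I * τ) ^ 2) ^ 2 := by
  have h : Complex.exp (2 * Real.pi * I * (0 + τ / 2)) = Complex.exp (Real.pi * I * τ) := by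
    congr 1; ring
  rw [th2_eq, jacobiTheta₂_eq_qPoch _ hτ, h, inv_mul_cancel₀ (Complex.exp_ne_zero _),
    qPoch_eq_mul (-1) (norm_nome_sq_lt_one hτ), zero_add, ← pow_two, neg_one_mul]
  ring

lemma qPoch_mul_mul_eq_one {p : ℂ} (hp : ‖p‖ < 1) :
    qPoch p (p ^ 2) * qPoch (-p) (p ^ 2) * qPoch (-p ^ 2) (p ^ 2) = 1 := by
  have hq := norm_sq_lt_one hp
  have h0 := qPoch_self_ne_zero hq
  have h1 := qPoch_mul_qPoch_neg p hq
  have h2 := qPoch_mul_qPoch_neg (p ^ 2) hq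
  have h3 := qPoch_even_mul_odd (p ^ 2) hq
  have h4 : p ^ 2 * p ^ 2 = (p ^ 2) ^ 2 := by ring
  rw [h4] at h3
  apply mul_left_cancel₀ h0
  rw [mul_one, h1]
  linear_combination qPoch (p ^ 2) ((p ^ 2) ^ 2) * h2 - h3

lemma qPoch_neg_self {p : ℂ} (hp : ‖p‖ < 1) :
    qPoch (-p) (-p) = qPoch (-p) (p ^ 2) * qPoch (p ^ 2) (p ^ 2) := by
  have h := qPoch_even_mul_odd (-p) (x := -p) (by rwa [norm_neg])
  rwa [neg_sq, neg_mul_neg, ← pow_two] at h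

lemma th2_mul_th4_mul_th3_pow {τ : ℂ} (hτ : 0 < τ.im) :
    th2 τ 0 * th4 τ 0 * th3 τ 0 ^ 4 = 2 * Complex.exp (Real.pi * I * (τ / 4)) *
      qPoch (-Complex.exp (Real.pi * I * τ)) (-Complex.exp (Real.pi * I * τ)) ^ 6 := by
  have hp := cexp_two_pi_norm_lt hτ
  have h1 := qPoch_mul_mul_eq_one hp
  rw [th2_zero_eq hτ, th3_zero_eq hτ, th4_zero_eq hτ, qPoch_neg_self hp]
  generalize Complex.exp (Real.pi * I * τ) = p at *
  calc _ = 2 * Complex.exp (Real.pi * I * (τ / 4)) * (qPoch (-p) (p ^ 2) *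
        qPoch (p ^ 2) (p ^ 2)) ^ 6 *
        (qPoch p (p ^ 2) * qPoch (-p) (p ^ 2) * qPoch (-p ^ 2) (p ^ 2)) ^ 2 := by ring
    _ = _ := by rw [h1]; ring

/-- Jacobi's identity for the cube of the Euler function. -/
lemma hasSum_jacobi_cube {τ : ℂ} (hτ : 0 < τ.im) :
    HasSum (fun n : ℤ ↦ (2 * n + 1) * Complex.exp (Real.pi * I * n + Real.pi * I * (n * (n + 1)) * τ))
      (2 * qPoch (Complex.exp (Real.pi * I * τ) ^ 2) (Complex.exp (Real.pi * I * τ) ^ 2) ^ 3) := by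
  set p := Complex.exp (Real.pi * I * τ) with hpdef
  have hq : ‖p ^ 2‖ < 1 := norm_nome_sq_lt_one hτ
  have hprod : ∀ h : ℂ, jacobiTheta₂ (1 / 2 + τ / 2 + h) τ =
      (1 - Complex.exp (-(2 * Real.pi * I * h))) * (qPoch (p ^ 2) (p ^ 2) *
        (qPoch (Complex.exp (2 * Real.pi * I * h) * p ^ 2) (p ^ 2) *
        qPoch (Complex.exp (-(2 * Real.pi * I * h)) * p ^ 2) (p ^ 2))) := by
    intro h
    have e : Complex.exp (2 * Real.pi * I * (1 / 2 + τ / 2 + h)) =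
        -(Complex.exp (2 * Real.pi * I * h) * p) := by
      rw [neg_eq_neg_one_mul, ← Complex.exp_pi_mul_I, hpdef, ← Complex.exp_add, ← Complex.exp_add]
      congr 1
      ring
    have e2 : -((Complex.exp (2 * Real.pi * I * (1 / 2 + τ / 2 + h)))⁻¹ * p) =
        Complex.exp (-(2 * Real.pi * I * h)) := by
      have hp0 : p ≠ 0 := Complex.exp_ne_zero _
      rw [e, Complex.exp_neg]
      field_simp
    rw [jacobiTheta₂_eq_qPoch _ hτ, ← hpdef, e2, e,
      qPoch_eq_mul (Complex.exp (-(2 * Real.pi * I * h))) hq]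
    rw [neg_mul, neg_neg, mul_assoc _ p p, ← pow_two]
    ring
  have hd1 : HasDerivAt (fun h ↦ jacobiTheta₂ (1 / 2 + τ / 2 + h) τ)
      (jacobiTheta₂' (1 / 2 + τ / 2) τ) 0 := by
    have := hasDerivAt_jacobiTheta₂_fst (1 / 2 + τ / 2 + 0) hτ
    simpa using HasDerivAt.comp_const_add (1 / 2 + τ / 2) 0 this
  have hd2 : HasDerivAt (fun h ↦ jacobiTheta₂ (1 / 2 + τ / 2 + h) τ)
      (2 * Real.pi * I * qPoch (p ^ 2) (p ^ 2) ^ 3) 0 := by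
    have hg : HasDerivAt (fun h : ℂ ↦ 1 - Complex.exp (-(2 * Real.pi * I * h)))
        (2 * Real.pi * I) 0 := by
      have := (((hasDerivAt_id (0 : ℂ)).const_mul (2 * Real.pi * I)).fun_neg.cexp).const_sub 1
      simpa using this
    have hK : ContinuousAt (fun h ↦ qPoch (p ^ 2) (p ^ 2) *
        (qPoch (Complex.exp (2 * Real.pi * I * h) * p ^ 2) (p ^ 2) *
        qPoch (Complex.exp (-(2 * Real.pi * I * h)) * p ^ 2) (p ^ 2))) 0 := by
      have := continuous_qPoch hq
      exact Continuous.continuousAt (by fun_prop)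
    rw [funext hprod, hasDerivAt_iff_tendsto_slope]
    have hlim := (hasDerivAt_iff_tendsto_slope.mp hg).mul (hK.tendsto.mono_left nhdsWithin_le_nhds)
    simp only [mul_zero, neg_zero, Complex.exp_zero, one_mul] at hlim
    rw [show 2 * Real.pi * I * qPoch (p ^ 2) (p ^ 2) ^ 3 = 2 * Real.pi * I *
      (qPoch (p ^ 2) (p ^ 2) * (qPoch (p ^ 2) (p ^ 2) * qPoch (p ^ 2) (p ^ 2))) by ring]
    refine hlim.congr fun h ↦ ?_
    simp only [slope_def_field, mul_zero, neg_zero, Complex.exp_zero, sub_self, zero_mul]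
    ring
  have h0 : jacobiTheta₂ (1 / 2 + τ / 2) τ = 0 := by
    have := hprod 0
    rwa [add_zero, mul_zero, neg_zero, Complex.exp_zero, sub_self, zero_mul] at this
  have hs1 := hasSum_jacobiTheta₂'_term (1 / 2 + τ / 2) hτ
  have hs0 := hasSum_jacobiTheta₂_term (1 / 2 + τ / 2) hτ
  rw [hd1.unique hd2] at hs1
  rw [h0] at hs0
  have hpi : (Real.pi : ℂ) ≠ 0 := by exact_mod_cast Real.pi_ne_zero
  convert! (hs1.mul_left ((Real.pi * I)⁻¹)).add hs0 using 1
  · ext n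
    have : jacobiTheta₂_term n (1 / 2 + τ / 2) τ =
        Complex.exp (Real.pi * I * n + Real.pi * I * (n * (n + 1)) * τ) := by
      rw [jacobiTheta₂_term]
      congr 1
      ring
    rw [jacobiTheta₂'_term, this]
    field_simp
  · field_simp
    ring

lemma exists_hasDerivAt_jacobiTheta₂_add_mul (a b : ℂ) {τ : ℂ} (hτ : 0 < τ.im) :
    ∃ D, HasDerivAt (fun t ↦ jacobiTheta₂ (a + b * t) t) D τ ∧
      HasSum (fun n : ℤ ↦ (2 * Real.pi * I * n * b + Real.pi * I * n ^ 2) *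
        jacobiTheta₂_term n (a + b * τ) τ) D := by
  refine ⟨jacobiTheta₂_fderiv (a + b * τ) τ (b, 1), ?_, ?_⟩
  · have hl : HasDerivAt (fun t : ℂ ↦ (a + b * t, t)) (b, 1) τ := by
      have h1 : HasDerivAt (fun t : ℂ ↦ a + b * t) b τ := by
        simpa using ((hasDerivAt_id τ).const_mul b).const_add a
      exact h1.prodMk (hasDerivAt_id τ)
    exact (hasFDerivAt_jacobiTheta₂ (a + b * τ) hτ).comp_hasDerivAt
      (f := fun t : ℂ ↦ (a + b * t, t)) τ hl
  · have := (hasSum_jacobiTheta₂_term_fderiv (a + b * τ) hτ).mapL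
      (ContinuousLinearMap.apply ℂ ℂ ((b, 1) : ℂ × ℂ))
    convert! this using 1
    ext n
    simp [jacobiTheta₂_term_fderiv, jacobiTheta₂_term]
    ring

lemma hasSum_th4_zero {τ : ℂ} (hτ : 0 < τ.im) :
    HasSum (fun n : ℤ ↦ Complex.exp (Real.pi * I * n + Real.pi * I * n ^ 2 * τ)) (th4 τ 0) := by
  rw [th4_eq]
  convert! hasSum_jacobiTheta₂_term (0 + 1 / 2) hτ using 1
  ext n
  rw [jacobiTheta₂_term]
  congr 1
  ring

lemma hasSum_th2_zero {τ : ℂ} (hτ : 0 < τ.im) :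
    HasSum (fun n : ℤ ↦ Complex.exp (Real.pi * I * (n + 1 / 2) ^ 2 * τ)) (th2 τ 0) := by
  rw [th2_eq]
  convert! (hasSum_jacobiTheta₂_term (0 + τ / 2) hτ).mul_left _ using 1
  ext n
  rw [jacobiTheta₂_term, ← Complex.exp_add]
  congr 1
  ring

lemma exists_hasDerivAt_th4_zero {τ : ℂ} (hτ : 0 < τ.im) :
    ∃ D, HasDerivAt (fun t ↦ th4 t 0) D τ ∧ HasSum (fun n : ℤ ↦ Real.pi * I * n ^ 2 *
      Complex.exp (Real.pi * I * n + Real.pi * I * n ^ 2 * τ)) D := by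
  obtain ⟨D, hD, hs⟩ := exists_hasDerivAt_jacobiTheta₂_add_mul (1 / 2) 0 hτ
  refine ⟨D, ?_, ?_⟩
  · simp only [th4_eq]
    simpa only [zero_mul, add_zero, zero_add] using hD
  · convert! hs using 1
    ext n
    rw [mul_zero, zero_add, jacobiTheta₂_term]
    congr 2
    ring

lemma exists_hasDerivAt_th2_zero {τ : ℂ} (hτ : 0 < τ.im) :
    ∃ D, HasDerivAt (fun t ↦ th2 t 0) D τ ∧ HasSum (fun n : ℤ ↦ Real.pi * I * (n + 1 / 2) ^ 2 *
      Complex.exp (Real.pi * I * (n + 1 / 2) ^ 2 * τ)) D := by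
  obtain ⟨D, hD, hs⟩ := exists_hasDerivAt_jacobiTheta₂_add_mul 0 (1 / 2) hτ
  have he : HasDerivAt (fun t : ℂ ↦ Complex.exp (Real.pi * I * (0 + t / 4)))
      (Complex.exp (Real.pi * I * (0 + τ / 4)) * (Real.pi * I * (1 / 4))) τ :=
    ((((hasDerivAt_id τ).div_const 4).const_add 0).const_mul (Real.pi * I)).cexp
  refine ⟨Complex.exp (Real.pi * I * (0 + τ / 4)) * (Real.pi * I * (1 / 4)) *
    jacobiTheta₂ (0 + 1 / 2 * τ) τ + Complex.exp (Real.pi * I * (0 + τ / 4)) * D, ?_, ?_⟩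
  · refine (he.mul hD).congr_of_eventuallyEq (.of_forall fun t ↦ ?_)
    change th2 t 0 = Complex.exp _ * jacobiTheta₂ _ _
    rw [th2_eq]
    congr 2
    ring
  · have h0 := hasSum_jacobiTheta₂_term (0 + 1 / 2 * τ) hτ
    convert! (h0.mul_left _).add (hs.mul_left _) using 1
    ext n
    have : Complex.exp (Real.pi * I * (n + 1 / 2) ^ 2 * τ) =
        Complex.exp (Real.pi * I * (0 + τ / 4)) * jacobiTheta₂_term n (0 + 1 / 2 * τ) τ := by
      rw [jacobiTheta₂_term, ← Complex.exp_add]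
      congr 1
      ring
    rw [this]
    ring

lemma HasSum.mul_sub_mul_eq_tsum {f g f' g' : ℤ → ℂ} {a b a' b' : ℂ} (hf : HasSum f a)
    (hg : HasSum g b) (hf' : HasSum f' a') (hg' : HasSum g' b') :
    a * b - a' * b' = ∑' p : ℤ × ℤ, (f p.1 * g p.2 - f' p.1 * g' p.2) := by
  have h : HasSum (fun p : ℤ × ℤ ↦ f p.1 * g p.2) (a * b) :=
    hf.mul hg (summable_mul_of_summable_norm hf.summable.norm hg.summable.norm)
  have h' : HasSum (fun p : ℤ × ℤ ↦ f' p.1 * g' p.2) (a' * b') :=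
    hf'.mul hg' (summable_mul_of_summable_norm hf'.summable.norm hg'.summable.norm)
  exact (h.sub h').tsum_eq.symm

lemma wronskian_term_eq (τ : ℂ) (k l : ℤ) :
    Real.pi * I * (k + 1 / 2) ^ 2 * Complex.exp (Real.pi * I * (k + 1 / 2) ^ 2 * τ) *
        Complex.exp (Real.pi * I * l + Real.pi * I * l ^ 2 * τ) -
      Complex.exp (Real.pi * I * (k + 1 / 2) ^ 2 * τ) *
        (Real.pi * I * l ^ 2 * Complex.exp (Real.pi * I * l + Real.pi * I * l ^ 2 * τ)) =
    Real.pi * I / 4 * Complex.exp (Real.pi * I * (τ / 4)) *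
      ((2 * (k + l : ℤ) + 1) * Complex.exp (Real.pi * I * (k + l : ℤ) +
        Real.pi * I * ((k + l : ℤ) * ((k + l : ℤ) + 1)) * ((τ + 1) / 2)) *
      ((2 * (k - l : ℤ) + 1) * Complex.exp (Real.pi * I * (k - l : ℤ) +
        Real.pi * I * ((k - l : ℤ) * ((k - l : ℤ) + 1)) * ((τ + 1) / 2)))) := by
  obtain ⟨r, hr⟩ := Int.even_mul_succ_self k
  obtain ⟨s, hs⟩ := Int.even_mul_succ_self (l - 1)
  have hr' : (k : ℂ) * (k + 1) = r + r := by exact_mod_cast hr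
  have hs' : ((l : ℂ) - 1) * (l - 1 + 1) = s + s := by exact_mod_cast hs
  have : Complex.exp (Real.pi * I * (k + 1 / 2) ^ 2 * τ) *
      Complex.exp (Real.pi * I * l + Real.pi * I * l ^ 2 * τ) =
      Complex.exp (Real.pi * I * (τ / 4)) *
      (Complex.exp (Real.pi * I * (k + l) + Real.pi * I * ((k + l) * (k + l + 1)) *
        ((τ + 1) / 2)) *
      Complex.exp (Real.pi * I * (k - l) + Real.pi * I * ((k - l) * (k - l + 1)) *
        ((τ + 1) / 2))) := by
    rw [← Complex.exp_add, ← Complex.exp_add, ← Complex.exp_add,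
      Complex.exp_eq_exp_iff_exists_int]
    refine ⟨-(k + r + s), ?_⟩
    push_cast
    linear_combination (-Real.pi * I) * hr' - Real.pi * I * hs'
  push_cast
  linear_combination (Real.pi * I * (k + 1 / 2) ^ 2 - Real.pi * I * l ^ 2) * this

lemma wronskian_th2_th4 {τ D2 D4 : ℂ} (hτ : 0 < τ.im) (h2 : HasDerivAt (fun t ↦ th2 t 0) D2 τ)
    (h4 : HasDerivAt (fun t ↦ th4 t 0) D4 τ) :
    D2 * th4 τ 0 - th2 τ 0 * D4 = Real.pi * I / 4 * (th2 τ 0 * th4 τ 0 * th3 τ 0 ^ 4) := by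
  obtain ⟨D2', hD2, hs2⟩ := exists_hasDerivAt_th2_zero hτ
  obtain ⟨D4', hD4, hs4⟩ := exists_hasDerivAt_th4_zero hτ
  obtain rfl := h2.unique hD2
  obtain rfl := h4.unique hD4
  have ht2 := hasSum_th2_zero hτ
  have ht4 := hasSum_th4_zero hτ
  have hτ' : 0 < ((τ + 1) / 2).im := by
    rw [show (τ + 1) / 2 = (τ + 1) / (2 : ℝ) by norm_num, Complex.div_ofReal_im]
    simpa using hτ
  have hc := hasSum_jacobi_cube hτ'
  have hp : Complex.exp (Real.pi * I * ((τ + 1) / 2)) ^ 2 = -Complex.exp (Real.pi * I * τ) := by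
    rw [← Complex.exp_nat_mul, neg_eq_neg_one_mul, ← Complex.exp_pi_mul_I, ← Complex.exp_add]
    congr 1
    push_cast
    ring
  rw [hp] at hc
  set c : ℤ → ℂ := fun n ↦ (2 * n + 1) *
    Complex.exp (Real.pi * I * n + Real.pi * I * (n * (n + 1)) * ((τ + 1) / 2)) with hcdef
  have hrefl : ∀ u, c (-1 - u) = c u := by
    intro u
    have : Complex.exp (Real.pi * I * (-1 - u) + Real.pi * I * ((-1 - u) * (-1 - u + 1)) *
        ((τ + 1) / 2)) = -Complex.exp (Real.pi * I * u + Real.pi * I * (u * (u + 1)) *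
        ((τ + 1) / 2)) := by
      have hneg : ∀ x : ℂ, -x = Complex.exp (Real.pi * I) * x := fun x ↦ by
        rw [Complex.exp_pi_mul_I, neg_one_mul]
      rw [hneg (Complex.exp _), ← Complex.exp_add, Complex.exp_eq_exp_iff_exists_int]
      refine ⟨-1 - u, ?_⟩
      push_cast
      ring
    simp only [hcdef]
    push_cast
    rw [this]
    ring
  have hF := summable_mul_of_summable_norm hc.summable.norm hc.summable.norm
  have hsq := tsum_mul_tsum_of_summable_norm hc.summable.norm hc.summable.norm
  rw [tsum_prod_eq_add_sub hF, hc.tsum_eq] at hsq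
  have hodd : ∑' p : ℤ × ℤ, c (p.1 + p.2 + 1) * c (p.1 - p.2) =
      ∑' p : ℤ × ℤ, c (p.1 + p.2) * c (p.1 - p.2) := by
    let e : ℤ × ℤ ≃ ℤ × ℤ :=
      { toFun := fun p ↦ (-p.2 - 1, -p.1 - 1)
        invFun := fun p ↦ (-p.2 - 1, -p.1 - 1)
        left_inv := fun p ↦ by simp
        right_inv := fun p ↦ by simp }
    rw [← e.tsum_eq]
    refine tsum_congr fun p ↦ ?_
    rw [← hrefl (p.1 + p.2)]
    simp only [e, Equiv.coe_fn_mk]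
    congr 2 <;> ring
  rw [hodd] at hsq
  have key : D2 * th4 τ 0 - th2 τ 0 * D4 = Real.pi * I / 4 * Complex.exp (Real.pi * I * (τ / 4)) *
      ∑' p : ℤ × ℤ, c (p.1 + p.2) * c (p.1 - p.2) := by
    rw [hs2.mul_sub_mul_eq_tsum ht4 ht2 hs4, ← tsum_mul_left]
    exact tsum_congr fun p ↦ wronskian_term_eq τ p.1 p.2
  rw [key, th2_mul_th4_mul_th3_pow hτ]
  linear_combination (-Real.pi * I / 8 * Complex.exp (Real.pi * I * (τ / 4))) * hsq

lemma th2_add_one (τ : ℂ) : th2 (τ + 1) 0 = Complex.exp (Real.pi * I / 4) * th2 τ 0 := by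
  rw [th2, th2, ← tsum_mul_left]
  refine tsum_congr fun n ↦ ?_
  obtain ⟨r, hr⟩ := Int.even_mul_succ_self n
  have hr' : (n : ℂ) * (n + 1) = r + r := by exact_mod_cast hr
  rw [← Complex.exp_add, Complex.exp_eq_exp_iff_exists_int, twoPiI]
  exact ⟨r, by linear_combination Real.pi * I * hr'⟩

lemma th4_add_one (τ : ℂ) : th4 (τ + 1) 0 = th3 τ 0 := by
  refine tsum_congr fun n ↦ ?_
  obtain ⟨r, hr⟩ := Int.even_mul_succ_self n
  have hr' : (n : ℂ) * (n + 1) = r + r := by exact_mod_cast hr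
  rw [neg_one_zpow_eq_exp, ← Complex.exp_add, Complex.exp_eq_exp_iff_exists_int, twoPiI]
  exact ⟨r, by linear_combination Real.pi * I * hr'⟩

lemma th3_add_one (τ : ℂ) : th3 (τ + 1) 0 = th4 τ 0 := by
  refine tsum_congr fun n ↦ ?_
  obtain ⟨r, hr⟩ := Int.even_mul_succ_self (n - 1)
  have hr' : ((n : ℂ) - 1) * (n - 1 + 1) = r + r := by exact_mod_cast hr
  rw [neg_one_zpow_eq_exp, ← Complex.exp_add, Complex.exp_eq_exp_iff_exists_int, twoPiI]
  exact ⟨r, by linear_combination Real.pi * I * hr'⟩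

lemma wronskian_th2_th3 {τ D2 D3 : ℂ} (hτ : 0 < τ.im) (h2 : HasDerivAt (fun t ↦ th2 t 0) D2 τ)
    (h3 : HasDerivAt (fun t ↦ th3 t 0) D3 τ) :
    D2 * th3 τ 0 - th2 τ 0 * D3 = Real.pi * I / 4 * (th2 τ 0 * th3 τ 0 * th4 τ 0 ^ 4) := by
  have hτ' : 0 < (τ + 1).im := by simpa using hτ
  have hs : HasDerivAt (fun t : ℂ ↦ t - 1) 1 (τ + 1) := (hasDerivAt_id _).sub_const 1
  have hd2 : HasDerivAt (fun t ↦ th2 t 0) (Complex.exp (Real.pi * I / 4) * D2) (τ + 1) := by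
    have h : HasDerivAt (fun t ↦ th2 (t - 1) 0) D2 (τ + 1) :=
      HasDerivAt.comp_sub_const (τ + 1) 1 (by simpa using h2)
    refine (h.const_mul (Complex.exp (Real.pi * I / 4))).congr_of_eventuallyEq (.of_forall fun t ↦ ?_)
    simpa using th2_add_one (t - 1)
  have hd4 : HasDerivAt (fun t ↦ th4 t 0) D3 (τ + 1) := by
    have h : HasDerivAt (fun t ↦ th3 (t - 1) 0) D3 (τ + 1) :=
      HasDerivAt.comp_sub_const (τ + 1) 1 (by simpa using h3)
    refine h.congr_of_eventuallyEq (.of_forall fun t ↦ ?_)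
    simpa using th4_add_one (t - 1)
  have := wronskian_th2_th4 hτ' hd2 hd4
  rw [th2_add_one, th3_add_one, th4_add_one] at this
  apply mul_left_cancel₀ (Complex.exp_ne_zero (Real.pi * I / 4))
  linear_combination this

lemma etaF_eq_eta (τ : ℂ) : etaF τ = ModularForm.eta τ := by
  simp only [etaF, ModularForm.eta, ModularForm.eta_q_eq_pow, qq, twoPiI,
    Function.Periodic.qParam]
  norm_num

lemma E2_eq_eisensteinE2 (τ : UpperHalfPlane) : E2 τ = EisensteinSeries.E2 τ := by
  rw [EisensteinSeries.E2_eq_tsum_cexp, tsum_pnat_eq_tsum_succ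
    (f := fun n ↦ (ArithmeticFunction.sigma 1 n : ℂ) * Complex.exp (2 * Real.pi * I * τ) ^ n), E2]
  congr 2
  refine tsum_congr fun n ↦ ?_
  rw [ArithmeticFunction.sigma_one_apply, qq, twoPiI]
  push_cast
  rfl

lemma hasDerivAt_etaF {τ : ℂ} (hτ : 0 < τ.im) :
    HasDerivAt etaF (etaF τ * (Real.pi * I / 12 * E2 τ)) τ := by
  have h := ModularForm.logDeriv_eta_eq_E2 ⟨τ, hτ⟩
  rw [← E2_eq_eisensteinE2, logDeriv_apply, div_eq_iff (ModularForm.eta_ne_zero hτ)] at h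
  have hd := (ModularForm.differentiableAt_eta_of_mem_upperHalfPlaneSet hτ).hasDerivAt
  rw [funext etaF_eq_eta, mul_comm]
  exact h ▸ hd

lemma etaF_ne_zero {τ : ℂ} (hτ : 0 < τ.im) : etaF τ ≠ 0 := by
  rw [etaF_eq_eta]
  exact ModularForm.eta_ne_zero hτ

lemma etaF_eq_qPoch (τ : ℂ) : etaF τ = Complex.exp (Real.pi * I * τ / 12) *
    qPoch (Complex.exp (Real.pi * I * τ) ^ 2) (Complex.exp (Real.pi * I * τ) ^ 2) := by
  have hq : qq τ = Complex.exp (Real.pi * I * τ) ^ 2 := by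
    rw [← Complex.exp_nat_mul, qq, twoPiI]
    congr 1
    push_cast
    ring
  rw [etaF, qPoch, hq, twoPiI]
  congr 2
  · ring
  · simp only [pow_succ']

lemma th2_mul_th3_mul_th4 {τ : ℂ} (hτ : 0 < τ.im) :
    th2 τ 0 * th3 τ 0 * th4 τ 0 = 2 * etaF τ ^ 3 := by
  have h1 := qPoch_mul_mul_eq_one (cexp_two_pi_norm_lt hτ)
  have he : Complex.exp (Real.pi * I * τ / 12) ^ 3 = Complex.exp (Real.pi * I * (τ / 4)) := by
    rw [← Complex.exp_nat_mul]
    congr 1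
    push_cast
    ring
  rw [th2_zero_eq hτ, th3_zero_eq hτ, th4_zero_eq hτ, etaF_eq_qPoch, ← he]
  generalize Complex.exp (Real.pi * I * τ) = p at *
  calc _ = 2 * (Complex.exp (Real.pi * I * τ / 12) * qPoch (p ^ 2) (p ^ 2)) ^ 3 *
        (qPoch p (p ^ 2) * qPoch (-p) (p ^ 2) * qPoch (-p ^ 2) (p ^ 2)) ^ 2 := by ring
    _ = _ := by rw [h1]; ring

lemma th2_mul_etaF {τ : ℂ} (hτ : 0 < τ.im) : th2 τ 0 * etaF τ = 2 * etaF (2 * τ) ^ 2 := by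
  have h := qPoch_mul_qPoch_neg (Complex.exp (Real.pi * I * τ) ^ 2) (norm_nome_sq_lt_one hτ)
  have he : Complex.exp (Real.pi * I * (2 * τ) / 12) ^ 2 =
      Complex.exp (Real.pi * I * (τ / 4)) * Complex.exp (Real.pi * I * τ / 12) := by
    rw [← Complex.exp_nat_mul, ← Complex.exp_add]
    congr 1
    push_cast
    ring
  have hp : Complex.exp (Real.pi * I * (2 * τ)) = Complex.exp (Real.pi * I * τ) ^ 2 := by
    rw [← Complex.exp_nat_mul]
    congr 1
    push_cast
    ring
  rw [th2_zero_eq hτ, etaF_eq_qPoch, etaF_eq_qPoch, hp, mul_pow, he, ← h]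
  ring

lemma theta_zero_ne_zero {τ : ℂ} (hτ : 0 < τ.im) : th2 τ 0 ≠ 0 ∧ th3 τ 0 ≠ 0 ∧ th4 τ 0 ≠ 0 := by
  have h : th2 τ 0 * th3 τ 0 * th4 τ 0 ≠ 0 := by
    rw [th2_mul_th3_mul_th4 hτ]
    exact mul_ne_zero two_ne_zero (pow_ne_zero 3 (etaF_ne_zero hτ))
  exact ⟨left_ne_zero_of_mul (left_ne_zero_of_mul h), right_ne_zero_of_mul (left_ne_zero_of_mul h),
    right_ne_zero_of_mul h⟩

lemma Lam_two_eq {τ : ℂ} (hτ : 0 < τ.im) : Lam 2 τ = (th3 τ 0 ^ 4 + th4 τ 0 ^ 4) / 24 := by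
  obtain ⟨n2, n3, n4⟩ := theta_zero_ne_zero hτ
  have nη := etaF_ne_zero hτ
  have h2τ : 0 < (2 * τ).im := by simpa using hτ
  obtain ⟨D2, hD2, -⟩ := exists_hasDerivAt_th2_zero hτ
  obtain ⟨D4, hD4, -⟩ := exists_hasDerivAt_th4_zero hτ
  obtain ⟨D3, hD3⟩ : ∃ D3, HasDerivAt (fun t ↦ th3 t 0) D3 τ := by
    simp only [th3_eq]
    obtain ⟨D, hD, -⟩ := exists_hasDerivAt_jacobiTheta₂_add_mul 0 0 hτ
    exact ⟨D, by simpa only [zero_mul, add_zero] using hD⟩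
  have hη := hasDerivAt_etaF hτ
  have hη2 : HasDerivAt (fun t ↦ etaF (2 * t))
      (etaF (2 * τ) * (Real.pi * I / 12 * E2 (2 * τ)) * 2) τ :=
    (hasDerivAt_etaF h2τ).comp τ (by simpa using (hasDerivAt_id τ).const_mul 2)
  have hU : ∀ᶠ t : ℂ in nhds τ, 0 < t.im :=
    (isOpen_lt continuous_const Complex.continuous_im).mem_nhds hτ
  have e1 := (hD2.mul hη).unique
    (((hη2.pow 2).const_mul 2).congr_of_eventuallyEq (hU.mono fun t ht ↦ th2_mul_etaF ht))
  have e2 := ((hD2.mul hD3).mul hD4).unique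
    (((hη.pow 3).const_mul 2).congr_of_eventuallyEq (hU.mono fun t ht ↦ th2_mul_th3_mul_th4 ht))
  have w4 := wronskian_th2_th4 hτ hD2 hD4
  have w3 := wronskian_th2_th3 hτ hD2 hD3
  have p1 := th2_mul_etaF hτ
  have p2 := th2_mul_th3_mul_th4 hτ
  simp only [Pi.mul_apply] at e1 e2
  norm_num at e1 e2
  have f1 : D2 = th2 τ 0 * (Real.pi * I / 12 * (4 * E2 (2 * τ) - E2 τ)) := by
    apply mul_right_cancel₀ nη
    linear_combination e1 - Real.pi * I / 12 * 4 * E2 (2 * τ) * p1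
  have hpi : (Real.pi : ℂ) * I ≠ 0 := mul_ne_zero (by exact_mod_cast Real.pi_ne_zero) I_ne_zero
  have nn := mul_ne_zero hpi (mul_ne_zero (mul_ne_zero n2 n3) n4)
  have f2 : 4 * E2 (2 * τ) - 2 * E2 τ = th3 τ 0 ^ 4 + th4 τ 0 ^ 4 := by
    apply mul_left_cancel₀ nn
    linear_combination 4 * e2 + 4 * th3 τ 0 * w4 + 4 * th4 τ 0 * w3
      - 12 * th3 τ 0 * th4 τ 0 * f1 - Real.pi * I * E2 τ * p2
  rw [Lam]
  push_cast
  linear_combination f2 / 24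

/-- `(1/12)·φ_{0,1}(τ,z) + 2·Λ₂(τ)·φ_{-2,1}(τ,z) = ϑ₂(τ,z)²/ϑ₂(τ,0)²`. -/
theorem theta2_identity :
    ∀ τ z : ℂ, 0 < τ.im →
      1 / 12 * phi01 τ z + 2 * Lam 2 τ * phim21 τ z = th2 τ z ^ 2 / th2 τ 0 ^ 2 := by
  intro τ z hτ
  obtain ⟨n2, n3, n4⟩ := theta_zero_ne_zero hτ
  have nη := etaF_ne_zero hτ
  obtain ⟨A, B, hAB⟩ := exists_theta_sq τ hτ
  obtain ⟨h1, h2, h3, h4⟩ := hAB z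
  obtain ⟨-, k2, k3, k4⟩ := hAB 0
  have hη6 : etaF τ ^ 6 = th2 τ 0 ^ 2 * th3 τ 0 ^ 2 * th4 τ 0 ^ 2 / 4 := by
    linear_combination (-(th2 τ 0 * th3 τ 0 * th4 τ 0 + 2 * etaF τ ^ 3) / 4) *
      th2_mul_th3_mul_th4 hτ
  have r4 : th4 τ z ^ 2 * th2 τ 0 ^ 2 =
      th2 τ z ^ 2 * th4 τ 0 ^ 2 + th1 τ z ^ 2 * th3 τ 0 ^ 2 := by
    rw [h1, h2, h4, k2, k3, k4]
    ring
  have r3 : th3 τ z ^ 2 * th2 τ 0 ^ 2 =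
      th2 τ z ^ 2 * th3 τ 0 ^ 2 + th1 τ z ^ 2 * th4 τ 0 ^ 2 := by
    rw [h1, h2, h3, k2, k3, k4]
    ring
  rw [phi01, phim21, Lam_two_eq hτ, hη6]
  field_simp
  linear_combination 96 * th3 τ 0 ^ 2 * r4 + 96 * th4 τ 0 ^ 2 * r3
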